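/- Let N be a prime with N ≡ 3 (mod 4), let a, b be integers coprime to N, and let c1, c2, c4, h1, h2 be integers with h1 ≡ h2 ≡ 0 (mod N), c1 ≡ c4 (mod N) and c2 ≡ 0 (mod N). Then the set of triples counted by L(c1,c2,c4,h1,h2) is exactly {(d1, d2, d4) ∈ (ℤ/Nℤ)³ : d4 = −d1 and d1² + d2² ≠ 0 in ℤ/Nℤ}; in particular L(c1,c2,c4,h1,h2) = N² − 1. -/

import Mathlib

/-- `Lcount N a b c1 c2 c4 h1 h2` is the number of triples `(d1, d2, d4)` of residues
modulo `N` satisfying `h1 ≡ a (d1 + d4) (mod N)`,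
`(d1 d4 - d2²) h2 ≡ b (d4 c1 - d2 c2 + d1 c4) (mod N)` and `d1 d4 - d2² ≢ 0 (mod N)`. -/
noncomputable def Lcount (N : ℕ) (a b c1 c2 c4 h1 h2 : ℤ) : ℕ :=
  Nat.card {d : ZMod N × ZMod N × ZMod N //
    ((h1 : ZMod N) = (a : ZMod N) * (d.1 + d.2.2)) ∧
    ((d.1 * d.2.2 - d.2.1 ^ 2) * (h2 : ZMod N) =
      (b : ZMod N) * (d.2.2 * (c1 : ZMod N) - d.2.1 * (c2 : ZMod N) + d.1 * (c4 : ZMod N))) ∧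
    d.1 * d.2.2 - d.2.1 ^ 2 ≠ 0}

theorem ZMod.sq_add_sq_eq_zero_iff_of_mod_four_eq_three {p : ℕ} [Fact p.Prime]
    (hp : p % 4 = 3) {x y : ZMod p} : x ^ 2 + y ^ 2 = 0 ↔ x = 0 ∧ y = 0 := by
  refine ⟨fun h => ?_, fun ⟨hx, hy⟩ => by simp [hx, hy]⟩
  have hy : y = 0 := by
    by_contra hy
    exact ZMod.mod_four_ne_three_of_sq_eq_neg_sq' hy (eq_neg_of_add_eq_zero_left h) hp
  exact ⟨by simpa [hy] using h, hy⟩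

theorem ZMod.intCast_ne_zero_of_gcd_eq_one {p : ℕ} (hp : p.Prime) {a : ℤ}
    (ha : Int.gcd a p = 1) : (a : ZMod p) ≠ 0 := by
  intro h
  have hdvd : (p : ℤ) ∣ a := (ZMod.intCast_zmod_eq_zero_iff_dvd a p).mp h
  have hp1 : p ∣ Int.gcd a p := Int.dvd_gcd hdvd dvd_rfl
  exact hp.one_lt.ne' (Nat.dvd_one.mp (ha ▸ hp1))

theorem stmt3 (N : ℕ) (hN : N.Prime) (h4 : N % 4 = 3)
    (a b c1 c2 c4 h1 h2 : ℤ) (ha : Int.gcd a N = 1) (hb : Int.gcd b N = 1)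
    (hh1 : (h1 : ZMod N) = 0) (hh2 : (h2 : ZMod N) = 0)
    (hc14 : (c1 : ZMod N) = (c4 : ZMod N)) (hc2 : (c2 : ZMod N) = 0) :
    ({d : ZMod N × ZMod N × ZMod N |
        ((h1 : ZMod N) = (a : ZMod N) * (d.1 + d.2.2)) ∧
        ((d.1 * d.2.2 - d.2.1 ^ 2) * (h2 : ZMod N) =
          (b : ZMod N) * (d.2.2 * (c1 : ZMod N) - d.2.1 * (c2 : ZMod N) + d.1 * (c4 : ZMod N))) ∧
        d.1 * d.2.2 - d.2.1 ^ 2 ≠ 0} =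
      {d : ZMod N × ZMod N × ZMod N | d.2.2 = -d.1 ∧ d.1 ^ 2 + d.2.1 ^ 2 ≠ 0}) ∧
    Lcount N a b c1 c2 c4 h1 h2 = N ^ 2 - 1 := by
  have : Fact N.Prime := ⟨hN⟩
  have ha0 := ZMod.intCast_ne_zero_of_gcd_eq_one hN ha
  have hset : {d : ZMod N × ZMod N × ZMod N |
        ((h1 : ZMod N) = (a : ZMod N) * (d.1 + d.2.2)) ∧
        ((d.1 * d.2.2 - d.2.1 ^ 2) * (h2 : ZMod N) =
          (b : ZMod N) * (d.2.2 * (c1 : ZMod N) - d.2.1 * (c2 : ZMod N) + d.1 * (c4 : ZMod N))) ∧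
        d.1 * d.2.2 - d.2.1 ^ 2 ≠ 0} =
      {d : ZMod N × ZMod N × ZMod N | d.2.2 = -d.1 ∧ d.1 ^ 2 + d.2.1 ^ 2 ≠ 0} := by
    ext ⟨x, y, z⟩
    simp only [Set.mem_ofPred_eq, hh1, hh2, hc14, hc2]
    have hneg : x * -x - y ^ 2 = -(x ^ 2 + y ^ 2) := by ring
    constructor
    · rintro ⟨h, -, hdet⟩
      obtain rfl : z = -x :=
        eq_neg_of_add_eq_zero_right ((mul_eq_zero.mp h.symm).resolve_left ha0)
      exact ⟨rfl, by rwa [hneg, neg_ne_zero] at hdet⟩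
    · rintro ⟨rfl, hdet⟩
      exact ⟨by ring, by ring, by rwa [hneg, neg_ne_zero]⟩
  refine ⟨hset, ?_⟩
  have himage : {d : ZMod N × ZMod N × ZMod N | d.2.2 = -d.1 ∧ d.1 ^ 2 + d.2.1 ^ 2 ≠ 0} =
      (fun q : ZMod N × ZMod N => (q.1, q.2, -q.1)) '' {0}ᶜ := by
    ext ⟨x, y, z⟩
    simp only [Set.mem_ofPred_eq, Ne, ZMod.sq_add_sq_eq_zero_iff_of_mod_four_eq_three h4,
      Set.mem_image, Set.mem_compl_iff, Set.mem_singleton_iff, Prod.ext_iff, Prod.exists]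
    constructor
    · rintro ⟨rfl, h⟩
      exact ⟨x, y, h, rfl, rfl, rfl⟩
    · rintro ⟨x, y, h, rfl, rfl, rfl⟩
      exact ⟨rfl, h⟩
  have hinj : Function.Injective (fun q : ZMod N × ZMod N => (q.1, q.2, -q.1)) := by
    rintro ⟨x, y⟩ ⟨x', y'⟩ h
    simp only [Prod.mk.injEq] at h ⊢
    exact ⟨h.1, h.2.1⟩
  rw [Lcount, ← Set.coe_ofPred, hset, Nat.card_coe_set_eq, himage,
    Set.ncard_image_of_injective _ hinj, Set.ncard_compl, Set.ncard_singleton, Nat.card_prod,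
    Nat.card_zmod, sq]
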